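/- Set ĉ = c(ρ+κ) − ζκ/ρ. Then H(x) > 0 for every x ≤ ĉ and H(x) < 0 for every x ≥ ĉ + ψ(ĉ)/ψ'(ĉ); consequently the unique zero x̄ of H lies in the open interval (ĉ, ĉ + ψ(ĉ)/ψ'(ĉ)). -/

import Mathlib

open Real MeasureTheory

/-- The integral `∫₀^∞ t ^ s * exp (-t² / 2 + y t) dt` as a function of `s` and `y`. -/
noncomputable def gaussMellin (s y : ℝ) : ℝ :=
  ∫ t in Set.Ioi (0 : ℝ), t ^ s * Real.exp (-t ^ 2 / 2 + y * t)

theorem integrableOn_rpow_mul_exp_gauss {s : ℝ} (hs : -1 < s) (y : ℝ) :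
    IntegrableOn (fun t : ℝ => t ^ s * Real.exp (-t ^ 2 / 2 + y * t)) (Set.Ioi 0) := by
  have h := (integrableOn_rpow_mul_exp_neg_mul_sq (b := 1 / 4) (by norm_num) hs).const_mul
    (Real.exp (y ^ 2))
  refine Integrable.mono' h ?_ ?_
  · exact Measurable.aestronglyMeasurable (by fun_prop)
  · filter_upwards [ae_restrict_mem measurableSet_Ioi] with t ht
    have ht0 : 0 ≤ t ^ s := Real.rpow_nonneg (le_of_lt ht) s
    rw [Real.norm_of_nonneg (by positivity), mul_left_comm, ← Real.exp_add]
    refine mul_le_mul_of_nonneg_left (Real.exp_le_exp.2 ?_) ht0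
    nlinarith [sq_nonneg (t / 2 - y)]

theorem gaussMellin_pos {s : ℝ} (hs : -1 < s) (y : ℝ) : 0 < gaussMellin s y := by
  have hpos : ∀ t ∈ Set.Ioi (0 : ℝ), 0 < t ^ s * Real.exp (-t ^ 2 / 2 + y * t) := fun t ht =>
    mul_pos (Real.rpow_pos_of_pos ht s) (Real.exp_pos _)
  refine (setIntegral_pos_iff_support_of_nonneg_ae ?_
    (integrableOn_rpow_mul_exp_gauss hs y)).2 ?_
  · filter_upwards [ae_restrict_mem measurableSet_Ioi] with t ht using (hpos t ht).le
  · refine lt_of_lt_of_le ?_ (measure_mono fun t (ht : t ∈ Set.Ioi (0 : ℝ)) =>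
      ⟨(hpos t ht).ne', ht⟩)
    simp

theorem hasDerivAt_gaussMellin {s : ℝ} (hs : -1 < s) (y : ℝ) :
    HasDerivAt (gaussMellin s) (gaussMellin (s + 1) y) y := by
  refine (hasDerivAt_integral_of_dominated_loc_of_deriv_le
    (μ := volume.restrict (Set.Ioi (0 : ℝ)))
    (F := fun y t => t ^ s * Real.exp (-t ^ 2 / 2 + y * t))
    (F' := fun y t => t ^ (s + 1) * Real.exp (-t ^ 2 / 2 + y * t))
    (bound := fun t => t ^ (s + 1) * Real.exp (-t ^ 2 / 2 + (y + 1) * t))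
    (Metric.ball_mem_nhds y one_pos) ?_ (integrableOn_rpow_mul_exp_gauss hs y) ?_ ?_
    (integrableOn_rpow_mul_exp_gauss (by linarith) (y + 1)) ?_).2
  · exact Filter.Eventually.of_forall fun z =>
      Measurable.aestronglyMeasurable (by fun_prop)
  · exact Measurable.aestronglyMeasurable (by fun_prop)
  · filter_upwards [ae_restrict_mem measurableSet_Ioi] with t ht z hz
    have ht' : 0 < t := ht
    have hz' := (abs_lt.1 (by simpa [Real.dist_eq] using hz : |z - y| < 1)).2
    rw [Real.norm_of_nonneg (by positivity)]
    gcongr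
    linarith
  · filter_upwards [ae_restrict_mem measurableSet_Ioi] with t ht z _
    have h := ((((hasDerivAt_id z).mul_const t).const_add (-t ^ 2 / 2)).exp).const_mul (t ^ s)
    refine h.congr_deriv ?_
    rw [Real.rpow_add_one (ne_of_gt ht)]
    simp only [id]
    ring

/-- The function `y ↦ gaussMellin s y` is strictly log-convex. -/
theorem gaussMellin_mul_lt_mul {s : ℝ} (hs : -1 < s) {y z : ℝ} (hyz : y < z) :
    gaussMellin (s + 1) y * gaussMellin s z < gaussMellin s y * gaussMellin (s + 1) z := by
  have hs' : -1 < s + 1 := by linarith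
  have hy := gaussMellin_pos hs y
  set m := gaussMellin (s + 1) y / gaussMellin s y with hm
  have hi := fun w => integrableOn_rpow_mul_exp_gauss hs w
  have hi' := fun w => integrableOn_rpow_mul_exp_gauss hs' w
  let E := Real.exp ((z - y) * m)
  let d : ℝ → ℝ → ℝ := fun w t =>
    t ^ (s + 1) * Real.exp (-t ^ 2 / 2 + w * t) - m * (t ^ s * Real.exp (-t ^ 2 / 2 + w * t))
  have hd : ∀ w, IntegrableOn (d w) (Set.Ioi 0) := fun w => (hi' w).sub ((hi w).const_mul m)
  have hdval : ∀ w, ∫ t in Set.Ioi (0 : ℝ), d w t =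
      gaussMellin (s + 1) w - m * gaussMellin s w := fun w =>
    (integral_sub (hi' w) ((hi w).const_mul m)).trans
      (congrArg (gaussMellin (s + 1) w - ·) (integral_const_mul m _))
  let f : ℝ → ℝ := fun t => d z t - E * d y t
  have hfi : IntegrableOn f (Set.Ioi 0) := (hd z).sub ((hd y).const_mul E)
  have hfval : ∫ t in Set.Ioi (0 : ℝ), f t = gaussMellin (s + 1) z - m * gaussMellin s z := by
    have hmean : gaussMellin (s + 1) y - m * gaussMellin s y = 0 := by
      rw [hm, div_mul_cancel₀ _ hy.ne', sub_self]
    refine (integral_sub (hd z) ((hd y).const_mul E)).trans ?_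
    rw [integral_const_mul, hdval, hdval, hmean, mul_zero, sub_zero]
  have hfeq : ∀ t ∈ Set.Ioi (0 : ℝ), f t = t ^ s * Real.exp (-t ^ 2 / 2 + y * t) *
      ((t - m) * (Real.exp ((z - y) * t) - E)) := by
    intro t ht
    have he : Real.exp (-t ^ 2 / 2 + z * t) =
        Real.exp (-t ^ 2 / 2 + y * t) * Real.exp ((z - y) * t) := by
      rw [← Real.exp_add]; ring_nf
    simp only [f, d]
    rw [he, Real.rpow_add_one (ne_of_gt ht)]
    ring
  have hfpos : ∀ t ∈ Set.Ioi (0 : ℝ), t ≠ m → 0 < f t := by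
    intro t ht htm
    rw [hfeq t ht]
    refine mul_pos (mul_pos (Real.rpow_pos_of_pos ht s) (Real.exp_pos _)) ?_
    have hzy : 0 < z - y := sub_pos.2 hyz
    rcases lt_or_gt_of_ne htm with h | h
    · exact mul_pos_of_neg_of_neg (sub_neg.2 h)
        (sub_neg.2 (Real.exp_lt_exp.2 (mul_lt_mul_of_pos_left h hzy)))
    · exact mul_pos (sub_pos.2 h)
        (sub_pos.2 (Real.exp_lt_exp.2 (mul_lt_mul_of_pos_left h hzy)))
  have hint : 0 < ∫ t in Set.Ioi (0 : ℝ), f t := by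
    refine (setIntegral_pos_iff_support_of_nonneg_ae ?_ hfi).2 ?_
    · filter_upwards [ae_restrict_mem measurableSet_Ioi] with t ht
      rcases eq_or_ne t m with h | h
      · rw [hfeq t ht, h]; simp
      · exact (hfpos t ht h).le
    · have hsub : Set.Ioi (max 0 m) ⊆ Function.support f ∩ Set.Ioi 0 := fun t ht => by
        obtain ⟨h0, hmt⟩ := max_lt_iff.1 (Set.mem_Ioi.1 ht)
        exact ⟨(hfpos t h0 hmt.ne').ne', h0⟩
      exact lt_of_lt_of_le (by simp) (measure_mono hsub)
  rw [hfval, sub_pos, hm, div_mul_eq_mul_div, div_lt_iff₀ hy] at hint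
  linarith

/-- The quotient of `gaussMellin s` by its derivative is strictly decreasing. -/
theorem strictAnti_gaussMellin_div {s : ℝ} (hs : -1 < s) :
    StrictAnti fun y => gaussMellin s y / gaussMellin (s + 1) y := by
  intro y z hyz
  have hs' : -1 < s + 1 := by linarith
  change gaussMellin s z / gaussMellin (s + 1) z < gaussMellin s y / gaussMellin (s + 1) y
  rw [div_lt_div_iff₀ (gaussMellin_pos hs' z) (gaussMellin_pos hs' y)]
  linarith [gaussMellin_mul_lt_mul hs hyz]

/-- With `ĉ = c(ρ+κ) − ζκ/ρ`, `H > 0` on `(−∞, ĉ]` and `H < 0` on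
`[ĉ + ψ(ĉ)/ψ'(ĉ), ∞)`; hence every zero of `H` lies in `(ĉ, ĉ + ψ(ĉ)/ψ'(ĉ))`. -/
theorem H_sign_and_zero_location
    (κ σ ρ c ζ : ℝ) (hκ : 0 < κ) (hσ : 0 < σ) (hρ : 0 < ρ) (hc : 0 < c)
    (ψ : ℝ → ℝ)
    (hψ : ∀ x : ℝ, ψ x = (Real.Gamma (ρ / κ))⁻¹ *
      ∫ t in Set.Ioi (0 : ℝ), t ^ (ρ / κ - 1) *
        Real.exp (-t ^ 2 / 2 + ((x - ζ) * Real.sqrt (2 * κ) / σ) * t))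
    (H : ℝ → ℝ)
    (hH : ∀ x : ℝ, H x = c * (ρ + κ) - ζ * κ / ρ + ψ x / deriv ψ x - x)
    (chat : ℝ) (hchat : chat = c * (ρ + κ) - ζ * κ / ρ) :
    (∀ x : ℝ, x ≤ chat → 0 < H x) ∧
    (∀ x : ℝ, chat + ψ chat / deriv ψ chat ≤ x → H x < 0) ∧
    (∀ xbar : ℝ, H xbar = 0 →
      xbar ∈ Set.Ioo chat (chat + ψ chat / deriv ψ chat)) := by
  have hs : -1 < ρ / κ - 1 := by linarith [div_pos hρ hκ]
  have hs' : -1 < ρ / κ - 1 + 1 := by linarith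
  have hΓ : 0 < (Real.Gamma (ρ / κ))⁻¹ := inv_pos.2 (Real.Gamma_pos_of_pos (div_pos hρ hκ))
  have hb : 0 < Real.sqrt (2 * κ) / σ := by positivity
  set s := ρ / κ - 1
  set b := Real.sqrt (2 * κ) / σ
  have hψ' : ψ = fun x => (Real.Gamma (ρ / κ))⁻¹ * gaussMellin s ((x - ζ) * b) := by
    funext x
    rw [hψ x, mul_div_assoc]
    rfl
  have hderiv : ∀ x, deriv ψ x =
      (Real.Gamma (ρ / κ))⁻¹ * (gaussMellin (s + 1) ((x - ζ) * b) * b) := by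
    intro x
    have hlin : HasDerivAt (fun x : ℝ => (x - ζ) * b) b x := by
      simpa using ((hasDerivAt_id x).sub_const ζ).mul_const b
    rw [hψ']
    exact (((hasDerivAt_gaussMellin hs _).comp x hlin).const_mul _).deriv
  have hquot : ∀ x, ψ x / deriv ψ x =
      gaussMellin s ((x - ζ) * b) / gaussMellin (s + 1) ((x - ζ) * b) / b := by
    intro x
    rw [hderiv, hψ', mul_div_mul_left _ _ hΓ.ne', div_div]
  have hpos : ∀ x, 0 < ψ x / deriv ψ x := fun x => by
    rw [hquot]
    exact div_pos (div_pos (gaussMellin_pos hs _) (gaussMellin_pos hs' _)) hb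
  have hanti : ∀ x y, x < y → ψ y / deriv ψ y < ψ x / deriv ψ x := fun x y hxy => by
    rw [hquot, hquot]
    exact div_lt_div_of_pos_right (strictAnti_gaussMellin_div hs
      (mul_lt_mul_of_pos_right (sub_lt_sub_right hxy ζ) hb)) hb
  have hleft : ∀ x, x ≤ chat → 0 < H x := fun x hx => by
    rw [hH, ← hchat]
    linarith [hpos x]
  have hright : ∀ x, chat + ψ chat / deriv ψ chat ≤ x → H x < 0 := fun x hx => by
    rw [hH, ← hchat]
    linarith [hanti chat x (by linarith [hpos chat])]
  refine ⟨hleft, hright, fun x hx => ⟨?_, ?_⟩⟩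
  · by_contra! h
    exact (hleft x h).ne' hx
  · by_contra! h
    exact (hright x h).ne hx
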